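/- arXiv:2508.16979 — 2 statements merged into one kernel-verified Lean document; each statement's English description precedes it below -/
import Mathlib

section
/- Let A be an m×n quaternion matrix, α and γ real numbers, and let (X_k) be the sequence of n×m quaternion matrices defined by X_0 = α·Aᴴ and X_{k+1} = (1+γ)·X_k − γ·(X_k·A·X_k). Then for every k, the matrices A·X_k and X_k·A are Hermitian, i.e., (A·X_k)ᴴ = A·X_k and (X_k·A)ᴴ = X_k·A. -/
open Matrix Quaternion

/-- Conjugate transposition of quaternion matrices commutes with real scalar multiplication. -/
theorem Quaternion.conjTranspose_real_smul {ι κ : Type*} (a : ℝ) (M : Matrix ι κ ℍ[ℝ]) :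
    (a • M)ᴴ = a • Mᴴ := by
  ext1 i j
  exact Quaternion.star_smul a (M j i)

/-- A real quadratic polynomial without constant term in a Hermitian quaternion matrix is
Hermitian. -/
theorem Matrix.IsHermitian.smul_sub_smul_mul_self {ι : Type*} [Fintype ι]
    {H : Matrix ι ι ℍ[ℝ]} (hH : H.IsHermitian) (a b : ℝ) :
    (a • H - b • (H * H)).IsHermitian := by
  simp only [Matrix.IsHermitian, conjTranspose_sub, Quaternion.conjTranspose_real_smul,
    conjTranspose_mul, hH.eq]

/-- With the scaled-adjoint initialization `X 0 = α • Aᴴ`, every damped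
Newton–Schulz iterate gives Hermitian products `A * X k` and `X k * A`. -/
theorem quaternion_NS_products_hermitian {m n : ℕ}
    (A : Matrix (Fin m) (Fin n) ℍ[ℝ]) (α γ : ℝ)
    (X : ℕ → Matrix (Fin n) (Fin m) ℍ[ℝ])
    (hX0 : X 0 = α • Aᴴ)
    (hX : ∀ k, X (k + 1) = (1 + γ) • X k - γ • (X k * A * X k)) :
    ∀ k, (A * X k)ᴴ = A * X k ∧ (X k * A)ᴴ = X k * A := by
  intro k
  induction k with
  | zero =>
    simp only [hX0, Matrix.mul_smul, Matrix.smul_mul,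
      Quaternion.conjTranspose_real_smul, conjTranspose_mul, conjTranspose_conjTranspose, and_self]
  | succ k ih =>
    have left : A * X (k + 1) = (1 + γ) • (A * X k) - γ • (A * X k * (A * X k)) := by
      simp only [hX, Matrix.mul_sub, Matrix.mul_smul, Matrix.mul_assoc]
    have right : X (k + 1) * A = (1 + γ) • (X k * A) - γ • (X k * A * (X k * A)) := by
      simp only [hX, Matrix.sub_mul, Matrix.smul_mul, Matrix.mul_assoc]
    rw [left, right]
    exact ⟨IsHermitian.smul_sub_smul_mul_self ih.1 _ _,
      IsHermitian.smul_sub_smul_mul_self ih.2 _ _⟩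
end

section
/- Let A be an m×n quaternion matrix, α and γ real numbers, and let (X_k) be the sequence of n×m quaternion matrices defined by X_0 = α·Aᴴ and X_{k+1} = (1+γ)·X_k − γ·(X_k·A·X_k). Then for every k there exists a real polynomial q such that A·X_k = q(A·X_0), where q is evaluated at the m×m quaternion matrix A·X_0 in the real algebra of m×m quaternion matrices (constant term acting as a real multiple of the identity). -/
open Matrix Quaternion

/-- Each `A * X k` of the damped Newton–Schulz iteration with `X 0 = α • Aᴴ`
is a real polynomial in `A * X 0`, evaluated in the real algebra of
`m × m` quaternion matrices. -/
theorem quaternion_NS_AXk_polynomial_in_AX0 {m n : ℕ}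
    (A : Matrix (Fin m) (Fin n) ℍ[ℝ]) (α γ : ℝ)
    (X : ℕ → Matrix (Fin n) (Fin m) ℍ[ℝ])
    (hX0 : X 0 = α • Aᴴ)
    (hX : ∀ k, X (k + 1) = (1 + γ) • X k - γ • (X k * A * X k)) :
    ∀ k, ∃ q : Polynomial ℝ, A * X k = Polynomial.aeval (A * X 0) q := by
  intro k
  induction k with
  | zero => exact ⟨Polynomial.X, (Polynomial.aeval_X _).symm⟩
  | succ k ih =>
    obtain ⟨q, hq⟩ := ih
    refine ⟨(1 + γ) • q - γ • (q * q), ?_⟩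
    rw [hX, map_sub, map_smul, map_smul, map_mul, ← hq, Matrix.mul_sub, Matrix.mul_smul,
      Matrix.mul_smul, Matrix.mul_assoc (X k), ← Matrix.mul_assoc A]
end
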